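/- arXiv:1807.00215 — 2 statements merged into one kernel-verified Lean document; each statement's English description precedes it below -/
import Mathlib

section
/- Let s and t be pseudo-secondary structures on n positions. If dg(s) ≥ dg(t), then either |s| ≤ |t|, or n is even, |s| = n/2 and |t| = n/2 − 1. -/
/-- A pseudo-secondary structure on `n` positions: a partial matching on
`{1,…,n}`, i.e. a set of pairs `(i,j)` with `1 ≤ i < j ≤ n` in which no
position occurs in more than one pair (crossings allowed, θ = 0). -/
def IsPseudo (n : ℕ) (s : Finset (ℕ × ℕ)) : Prop :=
  (∀ p ∈ s, 1 ≤ p.1 ∧ p.1 < p.2 ∧ p.2 ≤ n) ∧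
  (∀ p ∈ s, ∀ q ∈ s, p ≠ q →
    p.1 ≠ q.1 ∧ p.1 ≠ q.2 ∧ p.2 ≠ q.1 ∧ p.2 ≠ q.2)

/-- `t` is obtained from `s` by adding or removing exactly one pair. -/
def Neighbor (s t : Finset (ℕ × ℕ)) : Prop :=
  (∃ p, p ∉ s ∧ t = insert p s) ∨ (∃ p, p ∈ s ∧ t = s.erase p)

/-- The degree `dg` of a pseudo-secondary structure `s` on `n` positions:
the number of pseudo-secondary structures on `n` positions obtainable from
`s` by adding or removing exactly one pair. -/
noncomputable def dg (n : ℕ) (s : Finset (ℕ × ℕ)) : ℕ :=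
  Set.ncard {t : Finset (ℕ × ℕ) | IsPseudo n t ∧ Neighbor s t}

def freeSet (n : ℕ) (s : Finset (ℕ × ℕ)) : Finset ℕ :=
  Finset.Icc 1 n \ (s.image Prod.fst ∪ s.image Prod.snd)

def addable (n : ℕ) (s : Finset (ℕ × ℕ)) : Finset (ℕ × ℕ) :=
  (freeSet n s).offDiag.filter (fun p => p.1 < p.2)

theorem freeSet_card (n : ℕ) (s : Finset (ℕ × ℕ)) (hs : IsPseudo n s) :
    (freeSet n s).card + 2 * s.card = n := by
  obtain ⟨h1, h2⟩ := hs
  have c1 : (s.image Prod.fst).card = s.card := by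
    apply Finset.card_image_of_injOn
    intro p hp q hq hpq
    by_contra hne
    exact (h2 p hp q hq hne).1 hpq
  have c2 : (s.image Prod.snd).card = s.card := by
    apply Finset.card_image_of_injOn
    intro p hp q hq hpq
    by_contra hne
    exact (h2 p hp q hq hne).2.2.2 hpq
  have hd : Disjoint (s.image Prod.fst) (s.image Prod.snd) := by
    rw [Finset.disjoint_left]
    intro a ha hb
    obtain ⟨p, hp, rfl⟩ := Finset.mem_image.1 ha
    obtain ⟨q, hq, hpq⟩ := Finset.mem_image.1 hb
    by_cases hne : p = q
    · subst hne
      have := (h1 p hp).2.1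
      omega
    · exact (h2 p hp q hq hne).2.1 hpq.symm
  have hsub : s.image Prod.fst ∪ s.image Prod.snd ⊆ Finset.Icc 1 n := by
    intro a ha
    rw [Finset.mem_Icc]
    rcases Finset.mem_union.1 ha with ha | ha
    · obtain ⟨p, hp, rfl⟩ := Finset.mem_image.1 ha
      have := h1 p hp
      omega
    · obtain ⟨p, hp, rfl⟩ := Finset.mem_image.1 ha
      have := h1 p hp
      omega
  have h := Finset.card_sdiff_add_card_eq_card hsub
  rw [Finset.card_union_of_disjoint hd, c1, c2, Nat.card_Icc] at h
  unfold freeSet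
  omega

theorem two_mul_addable_card (n : ℕ) (s : Finset (ℕ × ℕ)) :
    2 * (addable n s).card + (freeSet n s).card
      = (freeSet n s).card * (freeSet n s).card := by
  have h1 := Finset.card_filter_add_card_filter_not (s := (freeSet n s).offDiag)
    (fun p : ℕ × ℕ => p.1 < p.2)
  have h2 : ((freeSet n s).offDiag.filter (fun p => ¬ p.1 < p.2)).card
      = (addable n s).card := by
    apply Finset.card_bij (fun p _ => p.swap)
    · intro p hp
      simp only [addable, Finset.mem_filter, Finset.mem_offDiag, Prod.fst_swap,
        Prod.snd_swap] at hp ⊢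
      refine ⟨⟨hp.1.2.1, hp.1.1, hp.1.2.2.symm⟩, ?_⟩
      omega
    · intro p _ q _ h
      exact Prod.swap_injective h
    · intro p hp
      refine ⟨p.swap, ?_, Prod.swap_swap p⟩
      simp only [addable, Finset.mem_filter, Finset.mem_offDiag, Prod.fst_swap,
        Prod.snd_swap] at hp ⊢
      refine ⟨⟨hp.1.2.1, hp.1.1, hp.1.2.2.symm⟩, ?_⟩
      omega
  have h3 := Finset.offDiag_card (freeSet n s)
  have h4 : (freeSet n s).card ≤ (freeSet n s).card * (freeSet n s).card :=
    Nat.le_mul_self _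
  rw [h2] at h1
  unfold addable at *
  omega

theorem isPseudo_insert_iff (n : ℕ) (s : Finset (ℕ × ℕ)) (hs : IsPseudo n s)
    (p : ℕ × ℕ) : (p ∉ s ∧ IsPseudo n (insert p s)) ↔ p ∈ addable n s := by
  obtain ⟨h1, h2⟩ := hs
  simp only [addable, freeSet, Finset.mem_filter, Finset.mem_offDiag, Finset.mem_sdiff,
    Finset.mem_Icc, Finset.mem_union, Finset.mem_image, not_or, not_exists, not_and]
  constructor
  · rintro ⟨hp, k1, k2⟩
    have a := k1 p (Finset.mem_insert_self _ _)
    have b : ∀ q ∈ s, p.1 ≠ q.1 ∧ p.1 ≠ q.2 ∧ p.2 ≠ q.1 ∧ p.2 ≠ q.2 := fun q hq =>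
      k2 p (Finset.mem_insert_self _ _) q (Finset.mem_insert_of_mem hq)
        (fun e => hp (e ▸ hq))
    refine ⟨⟨⟨⟨a.1, by omega⟩, fun q hq => (b q hq).1.symm, fun q hq => (b q hq).2.1.symm⟩,
      ⟨⟨by omega, by omega⟩, fun q hq => (b q hq).2.2.1.symm,
        fun q hq => (b q hq).2.2.2.symm⟩, by omega⟩, a.2.1⟩
  · rintro ⟨⟨⟨a, b1, b2⟩, ⟨c, d1, d2⟩, _⟩, hlt⟩
    refine ⟨fun hp => b1 p hp rfl, ?_, ?_⟩
    · intro q hq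
      rcases Finset.mem_insert.1 hq with rfl | hq
      · exact ⟨a.1, hlt, c.2⟩
      · exact h1 q hq
    · intro q hq r hr hne
      rcases Finset.mem_insert.1 hq with rfl | hqs
      · rcases Finset.mem_insert.1 hr with rfl | hr
        · exact absurd rfl hne
        · exact ⟨Ne.symm (b1 r hr), Ne.symm (b2 r hr), Ne.symm (d1 r hr), Ne.symm (d2 r hr)⟩
      · rcases Finset.mem_insert.1 hr with rfl | hr
        · exact ⟨b1 q hqs, d1 q hqs, b2 q hqs, d2 q hqs⟩
        · exact h2 q hqs r hr hne

theorem dg_eq (n : ℕ) (s : Finset (ℕ × ℕ)) (hs : IsPseudo n s) :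
    dg n s = (addable n s).card + s.card := by
  have key : {t : Finset (ℕ × ℕ) | IsPseudo n t ∧ Neighbor s t}
      = (((addable n s).image (fun p => insert p s) ∪ s.image (fun p => s.erase p) :
        Finset (Finset (ℕ × ℕ))) : Set (Finset (ℕ × ℕ))) := by
    ext t
    simp only [Set.mem_ofPred_eq, Finset.coe_union, Finset.coe_image, Set.mem_union,
      Set.mem_image, Finset.mem_coe, Neighbor]
    constructor
    · rintro ⟨ht, ⟨p, hp, rfl⟩ | ⟨p, hp, rfl⟩⟩
      · exact Or.inl ⟨p, (isPseudo_insert_iff n s hs p).1 ⟨hp, ht⟩, rfl⟩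
      · exact Or.inr ⟨p, hp, rfl⟩
    · rintro (⟨p, hp, rfl⟩ | ⟨p, hp, rfl⟩)
      · have := (isPseudo_insert_iff n s hs p).2 hp
        exact ⟨this.2, Or.inl ⟨p, this.1, rfl⟩⟩
      · refine ⟨⟨fun q hq => hs.1 q (Finset.mem_of_mem_erase hq), fun q hq r hr =>
          hs.2 q (Finset.mem_of_mem_erase hq) r (Finset.mem_of_mem_erase hr)⟩,
          Or.inr ⟨p, hp, rfl⟩⟩
  have hnot : ∀ p ∈ addable n s, p ∉ s := fun p hp =>
    ((isPseudo_insert_iff n s hs p).2 hp).1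
  unfold dg
  rw [key, Set.ncard_coe_finset, Finset.card_union_of_disjoint,
    Finset.card_image_of_injOn, Finset.card_image_of_injOn]
  · intro p hp q hq h
    exact (Finset.erase_inj s hp).1 h
  · intro p hp q hq h
    exact (Finset.insert_inj (hnot p hp)).1 h
  · rw [Finset.disjoint_left]
    intro t ha hb
    obtain ⟨p, hp, rfl⟩ := Finset.mem_image.1 ha
    obtain ⟨q, hq, h⟩ := Finset.mem_image.1 hb
    have : p ∈ s.erase q := by rw [h]; exact Finset.mem_insert_self _ _
    exact hnot p hp (Finset.mem_of_mem_erase this)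

theorem stmt_10 (n : ℕ) (s t : Finset (ℕ × ℕ)) (hs : IsPseudo n s)
    (ht : IsPseudo n t) (h : dg n s ≥ dg n t) :
    s.card ≤ t.card ∨ (Even n ∧ 2 * s.card = n ∧ 2 * t.card + 2 = n) := by
  have es := dg_eq n s hs
  have et := dg_eq n t ht
  have as := two_mul_addable_card n s
  have at' := two_mul_addable_card n t
  have fs := freeSet_card n s hs
  have ft := freeSet_card n t ht
  by_cases hle : s.card ≤ t.card
  · exact Or.inl hle
  right
  rw [es, et] at h
  generalize (addable n s).card = A at *
  generalize (addable n t).card = B at *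
  generalize (freeSet n s).card = m at *
  generalize (freeSet n t).card = l at *
  obtain ⟨d, hd⟩ : ∃ d, s.card = t.card + 1 + d := ⟨s.card - t.card - 1, by omega⟩
  have hl : l = m + 2 * d + 2 := by omega
  have hz : m = 0 ∧ d = 0 := by
    subst hl
    constructor
    · by_contra hm
      have : 1 ≤ m := by omega
      nlinarith
    · by_contra hm
      have : 1 ≤ d := by omega
      nlinarith
  refine ⟨⟨s.card, by omega⟩, by omega, by omega⟩
end

section
/- Let n be even, let s ≠ t be pseudo-secondary structures on n positions with dg(s) ≥ dg(t), and let s', t' be pseudo-secondary structures on n+1 positions with s ≺ s', t ≺ t', |s'| = |s| + 1, |t'| = |t|, and dg(s') < dg(t'). Then |s| = |t| and 1 ≤ |s| ≤ n/2 − 1. -/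
/-- `s'` (on `n+1` positions) extends `s` (on `n` positions), written `s ≺ s'`:
either `s' = s` (position `n+1` unpaired), or `s' = s ∪ {(k, n+1)}` for some
position `k ∈ {1,…,n}` unpaired in `s`. -/
def ExtendsTo (n : ℕ) (s s' : Finset (ℕ × ℕ)) : Prop :=
  s' = s ∨ ∃ k, 1 ≤ k ∧ k ≤ n ∧ (∀ p ∈ s, p.1 ≠ k ∧ p.2 ≠ k) ∧
    s' = insert (k, n + 1) s

/-- Unpaired positions. -/
def freePos (n : ℕ) (s : Finset (ℕ × ℕ)) : Finset ℕ :=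
  (Finset.Icc 1 n) \ (s.image Prod.fst ∪ s.image Prod.snd)

lemma mem_freePos (n : ℕ) (s : Finset (ℕ × ℕ)) (k : ℕ) :
    k ∈ freePos n s ↔ (1 ≤ k ∧ k ≤ n) ∧ ∀ p ∈ s, p.1 ≠ k ∧ p.2 ≠ k := by
  unfold freePos
  simp only [Finset.mem_sdiff, Finset.mem_Icc, Finset.mem_union, Finset.mem_image]
  constructor
  · rintro ⟨h, h2⟩
    exact ⟨h, fun p hp => ⟨fun e => h2 (Or.inl ⟨p, hp, e⟩), fun e => h2 (Or.inr ⟨p, hp, e⟩)⟩⟩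
  · rintro ⟨h, h2⟩
    refine ⟨h, ?_⟩
    rintro (⟨p, hp, e⟩ | ⟨p, hp, e⟩)
    · exact (h2 p hp).1 e
    · exact (h2 p hp).2 e

lemma card_freePos (n : ℕ) (s : Finset (ℕ × ℕ)) (hs : IsPseudo n s) :
    (freePos n s).card + 2 * s.card = n := by
  obtain ⟨h1, h2⟩ := hs
  have c1 : (s.image Prod.fst).card = s.card := by
    apply Finset.card_image_of_injOn
    intro p hp q hq e
    by_contra hne
    exact (h2 p hp q hq hne).1 e
  have c2 : (s.image Prod.snd).card = s.card := by
    apply Finset.card_image_of_injOn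
    intro p hp q hq e
    by_contra hne
    exact (h2 p hp q hq hne).2.2.2 e
  have hd : Disjoint (s.image Prod.fst) (s.image Prod.snd) := by
    rw [Finset.disjoint_left]
    intro x hx hy
    obtain ⟨p, hp, rfl⟩ := Finset.mem_image.1 hx
    obtain ⟨q, hq, e⟩ := Finset.mem_image.1 hy
    by_cases hpq : p = q
    · subst hpq
      have := (h1 p hp).2.1
      omega
    · exact (h2 p hp q hq hpq).2.1 e.symm
  have hsub : s.image Prod.fst ∪ s.image Prod.snd ⊆ Finset.Icc 1 n := by
    intro x hx
    rw [Finset.mem_union, Finset.mem_image, Finset.mem_image] at hx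
    rw [Finset.mem_Icc]
    rcases hx with ⟨p, hp, rfl⟩ | ⟨p, hp, rfl⟩
    · have := h1 p hp
      omega
    · have := h1 p hp
      omega
  have h := Finset.card_sdiff_add_card_eq_card hsub
  rw [Finset.card_union_of_disjoint hd, c1, c2, Nat.card_Icc] at h
  unfold freePos
  omega

lemma card_lt_pairs (U : Finset ℕ) :
    2 * ((U ×ˢ U).filter (fun p => p.1 < p.2)).card + U.card = U.card * U.card := by
  have e1 : ((U ×ˢ U).filter (fun p => p.2 < p.1)).card
      = ((U ×ˢ U).filter (fun p => p.1 < p.2)).card := by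
    apply Finset.card_bij (fun p _ => p.swap)
    · intro p hp
      simp at hp ⊢
      tauto
    · intro p _ q _ h
      exact Prod.swap_injective h
    · intro p hp
      refine ⟨p.swap, ?_, by simp⟩
      simp at hp ⊢
      tauto
  have e2 : ((U ×ˢ U).filter (fun p => p.1 = p.2)).card = U.card := by
    symm
    apply Finset.card_bij (fun x _ => (x, x))
    · intro p hp
      simpa using hp
    · intro p _ q _ h
      exact (Prod.mk.inj h).1
    · rintro ⟨a, b⟩ hp
      simp at hp
      obtain ⟨⟨h1, h2⟩, rfl⟩ := hp
      exact ⟨a, h1, rfl⟩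
  have h1 := Finset.card_filter_add_card_filter_not (s := U ×ˢ U) (fun p => p.1 < p.2)
  have h2 := Finset.card_filter_add_card_filter_not
    (s := (U ×ˢ U).filter (fun p => ¬ p.1 < p.2)) (fun p => p.1 = p.2)
  rw [Finset.filter_filter, Finset.filter_filter] at h2
  have e3 : (U ×ˢ U).filter (fun p => ¬ p.1 < p.2 ∧ p.1 = p.2)
      = (U ×ˢ U).filter (fun p => p.1 = p.2) := by
    apply Finset.filter_congr
    intro p _
    omega
  have e4 : (U ×ˢ U).filter (fun p => ¬ p.1 < p.2 ∧ ¬ p.1 = p.2)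
      = (U ×ˢ U).filter (fun p => p.2 < p.1) := by
    apply Finset.filter_congr
    intro p _
    omega
  rw [e3, e4, e1, e2] at h2
  rw [Finset.card_product] at h1
  omega

lemma pseudo_insert (n : ℕ) (s : Finset (ℕ × ℕ)) (hs : IsPseudo n s) (p : ℕ × ℕ) :
    (p ∉ s ∧ IsPseudo n (insert p s)) ↔
      p ∈ (freePos n s ×ˢ freePos n s).filter (fun p => p.1 < p.2) := by
  simp only [Finset.mem_filter, Finset.mem_product, mem_freePos]
  constructor
  · rintro ⟨hp, h1, h2⟩
    have a := h1 p (Finset.mem_insert_self _ _)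
    refine ⟨⟨⟨by omega, ?_⟩, ⟨by omega, ?_⟩⟩, a.2.1⟩
    all_goals
      intro q hq
      have hne : q ≠ p := fun e => hp (e ▸ hq)
      have := h2 q (Finset.mem_insert_of_mem hq) p (Finset.mem_insert_self _ _) hne
      tauto
  · rintro ⟨⟨⟨a1, a2⟩, ⟨b1, b2⟩⟩, hlt⟩
    refine ⟨fun hp => (a2 p hp).1 rfl, ?_, ?_⟩
    · intro q hq
      rcases Finset.mem_insert.1 hq with rfl | hq
      · omega
      · exact hs.1 q hq
    · intro q hq r hr hne
      rcases Finset.mem_insert.1 hq with rfl | hq2 <;> rcases Finset.mem_insert.1 hr with rfl | hr2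
      · exact absurd rfl hne
      · have := a2 r hr2
        have := b2 r hr2
        omega
      · have := a2 q hq2
        have := b2 q hq2
        omega
      · exact hs.2 q hq2 r hr2 hne

lemma dg_formula (n : ℕ) (s : Finset (ℕ × ℕ)) (hs : IsPseudo n s) :
    2 * dg n s + (freePos n s).card
      = 2 * s.card + (freePos n s).card * (freePos n s).card := by
  have key : {t : Finset (ℕ × ℕ) | IsPseudo n t ∧ Neighbor s t} =
      ((((freePos n s ×ˢ freePos n s).filter (fun p => p.1 < p.2)).image (fun p => insert p s)
        ∪ s.image (fun p => s.erase p) : Finset (Finset (ℕ × ℕ))) : Set (Finset (ℕ × ℕ))) := by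
    ext t
    simp only [Set.mem_ofPred_eq, Finset.coe_union, Set.mem_union, Finset.mem_coe,
      Finset.mem_image, ← pseudo_insert n s hs]
    constructor
    · rintro ⟨ht, ⟨p, hp, rfl⟩ | ⟨p, hp, rfl⟩⟩
      · exact Or.inl ⟨p, ⟨hp, ht⟩, rfl⟩
      · exact Or.inr ⟨p, hp, rfl⟩
    · rintro (⟨p, ⟨hp, ht⟩, rfl⟩ | ⟨p, hp, rfl⟩)
      · exact ⟨ht, Or.inl ⟨p, hp, rfl⟩⟩
      · refine ⟨⟨fun q hq => hs.1 q (Finset.mem_of_mem_erase hq), fun q hq r hr =>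
          hs.2 q (Finset.mem_of_mem_erase hq) r (Finset.mem_of_mem_erase hr)⟩,
          Or.inr ⟨p, hp, rfl⟩⟩
  have c1 : (((freePos n s ×ˢ freePos n s).filter (fun p => p.1 < p.2)).image
      (fun p => insert p s)).card
      = ((freePos n s ×ˢ freePos n s).filter (fun p => p.1 < p.2)).card := by
    apply Finset.card_image_of_injOn
    intro p hp q hq e
    have hp' := ((pseudo_insert n s hs p).2 hp).1
    have : p ∈ insert q s := by
      have e' : insert p s = insert q s := e
      rw [← e']
      exact Finset.mem_insert_self _ _
    rcases Finset.mem_insert.1 this with h | h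
    · exact h
    · exact absurd h hp'
  have c2 : (s.image (fun p => s.erase p)).card = s.card := by
    apply Finset.card_image_of_injOn
    intro p hp q hq e
    by_contra hne
    have e' : s.erase p = s.erase q := e
    have : p ∈ s.erase q := Finset.mem_erase.2 ⟨hne, hp⟩
    rw [← e'] at this
    exact Finset.notMem_erase _ _ this
  have hd : Disjoint (((freePos n s ×ˢ freePos n s).filter (fun p => p.1 < p.2)).image
      (fun p => insert p s)) (s.image (fun p => s.erase p)) := by
    rw [Finset.disjoint_left]
    intro x hx hy
    obtain ⟨p, hp, rfl⟩ := Finset.mem_image.1 hx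
    obtain ⟨q, hq, e⟩ := Finset.mem_image.1 hy
    have hp' := ((pseudo_insert n s hs p).2 hp).1
    have : p ∈ s.erase q := by
      have e' : s.erase q = insert p s := e
      rw [e']
      exact Finset.mem_insert_self _ _
    exact hp' (Finset.mem_of_mem_erase this)
  have := card_lt_pairs (freePos n s)
  unfold dg
  rw [key, Set.ncard_coe_finset, Finset.card_union_of_disjoint hd, c1, c2]
  omega

theorem stmt_16 (n : ℕ) (hn : Even n) (s t s' t' : Finset (ℕ × ℕ))
    (hs : IsPseudo n s) (ht : IsPseudo n t) (hne : s ≠ t)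
    (hst : dg n s ≥ dg n t)
    (hs' : IsPseudo (n + 1) s') (ht' : IsPseudo (n + 1) t')
    (hes : ExtendsTo n s s') (het : ExtendsTo n t t')
    (hcs : s'.card = s.card + 1) (hct : t'.card = t.card)
    (hlt : dg (n + 1) s' < dg (n + 1) t') :
    s.card = t.card ∧ 1 ≤ s.card ∧ s.card ≤ n / 2 - 1 := by
  have a1 := card_freePos n s hs
  have a2 := card_freePos n t ht
  have a3 := card_freePos _ _ hs'
  have a4 := card_freePos _ _ ht'
  have b1 := dg_formula n s hs
  have b2 := dg_formula n t ht
  have b3 := dg_formula _ _ hs'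
  have b4 := dg_formula _ _ ht'
  obtain ⟨m, rfl⟩ := hn
  generalize (freePos (m + m) s).card = u at *
  generalize (freePos (m + m) t).card = v at *
  generalize (freePos (m + m + 1) s').card = u' at *
  generalize (freePos (m + m + 1) t').card = v' at *
  obtain ⟨x, rfl⟩ : ∃ x, u = 2 * x + 2 := ⟨u / 2 - 1, by omega⟩
  obtain ⟨y, rfl⟩ : ∃ y, v = 2 * y := ⟨v / 2, by omega⟩
  obtain rfl : u' = 2 * x + 1 := by omega
  obtain rfl : v' = 2 * y + 1 := by omega
  have hxy : y = x + 1 := by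
    rcases lt_trichotomy y (x + 1) with h | h | h
    · exfalso
      obtain ⟨d, rfl⟩ : ∃ d, x = y + d := ⟨x - y, by omega⟩
      nlinarith [Nat.zero_le (d * y), Nat.zero_le (d * d)]
    · exact h
    · exfalso
      obtain ⟨d, rfl⟩ : ∃ d, y = x + 2 + d := ⟨y - x - 2, by omega⟩
      nlinarith [Nat.zero_le (d * x), Nat.zero_le (d * d)]
  have hc : s.card = t.card := by omega
  refine ⟨hc, ?_, by omega⟩
  by_contra h0
  have h1 : s.card = 0 := by omega
  have h2 : t.card = 0 := by omega
  exact hne ((Finset.card_eq_zero.1 h1).trans (Finset.card_eq_zero.1 h2).symm)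
end
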